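/- Let π = (π_1, …, π_n) be a finite-state deterministic joint policy in an n-agent Markov game and let τ* be a set of best punishment strategies with respect to π. Then π ⋈ τ* is an ε-Nash equilibrium if and only if for every agent j, J_j((π ⋈ τ*)_{−j}, br_j(π ⋈ τ*)) − ε ≤ J_j(π), and moreover J_j(π ⋈ τ*) = J_j(π). -/

import Mathlib

/-- An `n`-agent Markov game: a finite set of states `S`, a finite action set `A i`
for each agent `i`, transition probabilities `P`, a finite horizon `H` and an
initial state `s0`. -/
structure MarkovGame (n : ℕ) where
  S : Type
  fintS : Fintype S
  A : Fin n → Type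
  fintA : ∀ i, Fintype (A i)
  nonemptyA : ∀ i, Nonempty (A i)
  P : S → (∀ i, A i) → PMF S
  H : ℕ
  s0 : S

namespace MarkovGame

variable {n : ℕ}

/-- A (finite) trajectory: an initial state together with a list of
(joint action, next state) steps. -/
abbrev Traj (G : MarkovGame n) : Type := G.S × List ((∀ i, G.A i) × G.S)

variable {G : MarkovGame n}

/-- The length `|ζ|` of a trajectory (its number of steps). -/
def Traj.len (ζ : Traj G) : ℕ := ζ.2.length

/-- The last state of a trajectory. -/
def Traj.last (ζ : Traj G) : G.S :=
  match ζ.2.getLast? with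
  | none => ζ.1
  | some p => p.2

/-- Extend a trajectory by one step. -/
def Traj.extend (ζ : Traj G) (a : ∀ i, G.A i) (s' : G.S) : Traj G :=
  (ζ.1, ζ.2 ++ [(a, s')])

/-- The prefix `ζ_{0:k}` of a trajectory, consisting of its first `k` steps. -/
def Traj.take (ζ : Traj G) (k : ℕ) : Traj G := (ζ.1, ζ.2.take k)

/-- A joint policy maps trajectories (histories) to distributions over joint actions. -/
def JointPolicy (G : MarkovGame n) : Type := Traj G → PMF (∀ i, G.A i)

/-- A policy for agent `i` maps trajectories to distributions over `i`'s actions. -/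
def AgentPolicy (G : MarkovGame n) (i : Fin n) : Type := Traj G → PMF (G.A i)

/-- One step of the game under joint policy `π` from history `ζ`. -/
noncomputable def stepDist (G : MarkovGame n) (π : JointPolicy G) (ζ : Traj G) :
    PMF (Traj G) :=
  (π ζ).bind fun a => (G.P (Traj.last ζ) a).map fun s' => Traj.extend ζ a s'

/-- `trajDist G π t` : the distribution over trajectories with `t` steps induced by
running `π` from the initial state `s0`. -/
noncomputable def trajDist (G : MarkovGame n) (π : JointPolicy G) : ℕ → PMF (Traj G)
  | 0 => PMF.pure (G.s0, ([] : List ((∀ i, G.A i) × G.S)))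
  | t + 1 => (trajDist G π t).bind (G.stepDist π)

/-- The score `J(π)` of a joint policy `π` with respect to a specification `φ`
(a predicate on trajectories): the probability that a trajectory of length `H`
drawn from `D_π` satisfies `φ`. -/
noncomputable def score (G : MarkovGame n) (φ : Traj G → Prop) (π : JointPolicy G) : ℝ :=
  ((trajDist G π G.H).toOuterMeasure {ζ | φ ζ}).toReal

/-- `(π_{-i}, π'_i)` : replace agent `i`'s behaviour in the joint policy `π` by the
agent policy `π'`. -/
noncomputable def replace (π : JointPolicy G) (i : Fin n) (π' : AgentPolicy G i) :
    JointPolicy G :=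
  fun ζ => (π ζ).bind fun a => (π' ζ).map fun ai => Function.update a i ai

/-- `π` is an `ε`-Nash equilibrium with respect to the specifications `φ i`:
no agent can improve its score by more than `ε` by unilaterally deviating. -/
def IsEpsNash (G : MarkovGame n) (φ : ∀ _ : Fin n, Traj G → Prop)
    (π : JointPolicy G) (ε : ℝ) : Prop :=
  ∀ (i : Fin n) (π' : AgentPolicy G i),
    G.score (φ i) (replace π i π') - ε ≤ G.score (φ i) π

/-- A finite-state deterministic joint policy `π = (M, α, σ, m0)`. -/
structure FSPolicy (G : MarkovGame n) where
  Mem : Type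
  fintMem : Fintype Mem
  upd : G.S → (∀ i, G.A i) → Mem → Mem
  act : G.S → Mem → ∀ i, G.A i
  m0 : Mem

namespace FSPolicy

/-- Run the memory update along the steps of a trajectory (the extended memory
update function). -/
def memRun (p : FSPolicy G) : G.S → List ((∀ i, G.A i) × G.S) → p.Mem → p.Mem
  | _, [], m => m
  | s, (a, s') :: rest, m => memRun p s' rest (p.upd s a m)

/-- The (deterministic) joint action played by `p` after history `ζ`. -/
def jointAct (p : FSPolicy G) (ζ : Traj G) : ∀ i, G.A i :=
  p.act (Traj.last ζ) (memRun p ζ.1 ζ.2 p.m0)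

/-- `p` viewed as a joint policy. -/
noncomputable def toJoint (p : FSPolicy G) : JointPolicy G :=
  fun ζ => PMF.pure (p.jointAct ζ)

/-- The joint action at step `k` of `ζ` deviates from what `p` prescribes. -/
def DevAt (p : FSPolicy G) (ζ : Traj G) (k : ℕ) : Prop :=
  ∃ h : k < ζ.2.length, (ζ.2.get ⟨k, h⟩).1 ≠ p.jointAct (Traj.take ζ k)

/-- Some agent has deviated from `p` along `ζ`. -/
def Deviated (p : FSPolicy G) (ζ : Traj G) : Prop := ∃ k, p.DevAt ζ k

/-- The agent that deviated from `p` the earliest along `ζ` (ties at the earliest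
deviation step broken by the fixed consistent rule of taking the least such agent). -/
noncomputable def deviator (p : FSPolicy G) (ζ : Traj G) (h : p.Deviated ζ) : Fin n := by
  classical
  have hk : p.DevAt ζ (Nat.find h) := Nat.find_spec h
  exact (Finset.univ.filter fun j : Fin n =>
      (ζ.2.get ⟨Nat.find h, hk.choose⟩).1 j ≠ p.jointAct (Traj.take ζ (Nat.find h)) j).min'
    (by
      rw [Finset.filter_nonempty_iff]
      by_contra hcon
      push_neg at hcon
      exact hk.choose_spec (funext fun j => hcon j (Finset.mem_univ j)))

end FSPolicy

/-- A set of punishment strategies: `τ i j hij` (for `i ≠ j`) is the policy that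
agent `i` uses to punish agent `j` once `j` has deviated. -/
def PunishmentStrategies (G : MarkovGame n) : Type :=
  ∀ (i j : Fin n), i ≠ j → AgentPolicy G i

/-- Independent product of a `Fin`-indexed family of distributions. -/
noncomputable def pmfPi : {m : ℕ} → {A : Fin m → Type} → (∀ i, PMF (A i)) → PMF (∀ i, A i)
  | 0, _, _ => PMF.pure fun i => i.elim0
  | _ + 1, _, d => (d 0).bind fun a0 => (pmfPi fun i => d i.succ).map fun r => Fin.cons a0 r

/-- The joint policy `π ⋈ τ`: each agent follows `p` as long as every past joint
action agrees with `p`; once some agent has deviated, every agent `i` plays the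
punishment strategy `τ i j` against the agent `j` that deviated the earliest. -/
noncomputable def FSPolicy.compose (p : FSPolicy G) (τ : PunishmentStrategies G) :
    JointPolicy G := fun ζ => by
  classical
  exact
    if h : p.Deviated ζ then
      pmfPi fun i =>
        if hij : i ≠ p.deviator ζ h then τ i (p.deviator ζ h) hij ζ
        else PMF.pure (p.jointAct ζ i)
    else PMF.pure (p.jointAct ζ)

end MarkovGame

namespace MarkovGame

variable {n : ℕ} {G : MarkovGame n}

theorem FSPolicy.not_deviated_start (p : FSPolicy G) (s : G.S) :
    ¬ p.Deviated (s, ([] : List ((∀ i, G.A i) × G.S))) := by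
  rintro ⟨k, hk, -⟩
  simp at hk

/-- Following `p` for one more step preserves agreement with `p`. -/
theorem FSPolicy.not_deviated_extend (p : FSPolicy G) {ζ : Traj G} (hζ : ¬ p.Deviated ζ)
    (s' : G.S) : ¬ p.Deviated (Traj.extend ζ (p.jointAct ζ) s') := by
  rintro ⟨k, hk, hne⟩
  have hle : k ≤ ζ.2.length := by
    simp only [Traj.extend, List.length_append, List.length_singleton] at hk
    omega
  have htake : Traj.take (Traj.extend ζ (p.jointAct ζ) s') k = Traj.take ζ k := by
    simp only [Traj.take, Traj.extend, List.take_append_of_le_length hle]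
  rw [htake] at hne
  rcases hle.lt_or_eq with hlt | rfl
  · refine hζ ⟨k, hlt, ?_⟩
    simpa [Traj.extend, List.getElem_append_left hlt] using hne
  · exact hne (by simp [Traj.extend, Traj.take])

/-- Trajectories generated by `p` never deviate from `p`. -/
theorem FSPolicy.not_deviated_of_mem_support (p : FSPolicy G) (t : ℕ) :
    ∀ ζ ∈ (trajDist G p.toJoint t).support, ¬ p.Deviated ζ := by
  induction t with
  | zero =>
    intro ζ hζ
    rw [trajDist, PMF.support_pure, Set.mem_singleton_iff] at hζ
    exact hζ ▸ p.not_deviated_start G.s0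
  | succ t ih =>
    intro ζ hζ
    rw [trajDist, PMF.mem_support_bind_iff] at hζ
    obtain ⟨ζ₀, hζ₀, hstep⟩ := hζ
    rw [stepDist, FSPolicy.toJoint, PMF.pure_bind, PMF.mem_support_map_iff] at hstep
    obtain ⟨s', -, rfl⟩ := hstep
    exact p.not_deviated_extend (ih ζ₀ hζ₀) s'

theorem FSPolicy.compose_of_not_deviated (p : FSPolicy G) (τ : PunishmentStrategies G)
    {ζ : Traj G} (hζ : ¬ p.Deviated ζ) : p.compose τ ζ = p.toJoint ζ := by
  simp [FSPolicy.compose, FSPolicy.toJoint, hζ]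

/-- Composing with punishment strategies does not change the distribution on trajectories. -/
theorem FSPolicy.trajDist_compose (p : FSPolicy G) (τ : PunishmentStrategies G) (t : ℕ) :
    trajDist G (p.compose τ) t = trajDist G p.toJoint t := by
  induction t with
  | zero => rfl
  | succ t ih =>
    rw [trajDist, trajDist, ih]
    ext ζ'
    rw [PMF.bind_apply, PMF.bind_apply]
    refine tsum_congr fun ζ => ?_
    by_cases hζ : ζ ∈ (trajDist G p.toJoint t).support
    · rw [stepDist, stepDist,
        p.compose_of_not_deviated τ (p.not_deviated_of_mem_support t ζ hζ)]
    · rw [(PMF.apply_eq_zero_iff _ _).2 hζ, zero_mul, zero_mul]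

theorem FSPolicy.score_compose (p : FSPolicy G) (τ : PunishmentStrategies G)
    (φ : Traj G → Prop) : G.score φ (p.compose τ) = G.score φ p.toJoint := by
  rw [score, score, p.trajDist_compose τ]

end MarkovGame

open MarkovGame in
/-- Let `π` be a finite-state deterministic joint policy and `τ*`
a set of best punishment strategies with respect to `π` (with `br` a best-response
map). Then `π ⋈ τ*` is an `ε`-Nash equilibrium iff for every agent `j`,
`J_j((π ⋈ τ*)_{-j}, br_j(π ⋈ τ*)) - ε ≤ J_j(π)`, and moreover
`J_j(π ⋈ τ*) = J_j(π)` for every agent `j`. -/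
theorem best_punishment_nash_iff
    {n : ℕ} {G : MarkovGame n} (φ : ∀ _ : Fin n, Traj G → Prop) (ε : ℝ)
    (p : FSPolicy G)
    (br : ∀ j : Fin n, JointPolicy G → AgentPolicy G j)
    (hbr : ∀ (j : Fin n) (π' : JointPolicy G) (π'' : AgentPolicy G j),
      G.score (φ j) (replace π' j π'') ≤ G.score (φ j) (replace π' j (br j π')))
    (τstar : PunishmentStrategies G)
    (hτstar : ∀ (j : Fin n) (τ : PunishmentStrategies G),
      G.score (φ j) (replace (p.compose τstar) j (br j (p.compose τstar))) ≤
        G.score (φ j) (replace (p.compose τ) j (br j (p.compose τ)))) :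
    (G.IsEpsNash φ (p.compose τstar) ε ↔
      ∀ j : Fin n,
        G.score (φ j) (replace (p.compose τstar) j (br j (p.compose τstar))) - ε ≤
          G.score (φ j) p.toJoint) ∧
    (∀ j : Fin n, G.score (φ j) (p.compose τstar) = G.score (φ j) p.toJoint) := by
  have hscore : ∀ j, G.score (φ j) (p.compose τstar) = G.score (φ j) p.toJoint :=
    fun j => p.score_compose τstar (φ j)
  refine ⟨⟨fun hNash j => ?_, fun hbest j π' => ?_⟩, hscore⟩
  · exact (hNash j _).trans_eq (hscore j)
  · rw [hscore j]
    exact (sub_le_sub_right (hbr j _ π') ε).trans (hbest j)
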